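/- arXiv:0908.2234 — 3 statements merged into one kernel-verified Lean document; each statement's English description precedes it below -/
import Mathlib

section
/- (Lemma 1, solution of the homological equation with small divisors.) Let n ≥ 1, τ > 0, α > 0, and let ω ∈ ℝⁿ satisfy |⟨k,ω⟩| ≥ α/|k|₁^τ for all k ∈ ℤⁿ, k ≠ 0. Let s > 0 and let v be a bounded holomorphic function on the strip S_s = {θ ∈ ℂⁿ : |Im θⱼ| < s for all j}, 2π-periodic in each variable, with zero mean: ∫_{[0,2π]ⁿ} v(θ) dθ = 0. Then for every σ with 0 < σ < s there exists a bounded holomorphic function u on S_{s−σ}, 2π-periodic in each variable, with zero mean, such that ∂_ω u := Σⱼ ωⱼ ∂u/∂θⱼ = v on S_{s−σ}, and sup_{S_{s−σ}} |u| ≤ (c/(α σ^{τ+n})) · sup_{S_s} |v|, where c depends only on n and τ. Moreover u is the unique zero-mean solution: any two bounded holomorphic 2π-periodic zero-mean solutions of ∂_ω u = v on strips S_{s−σ} agree on their common domain. -/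
open MeasureTheory

/-- the complex strip -/
def HStrip (n : ℕ) (s : ℝ) : Set (Fin n → ℂ) := {θ : Fin n → ℂ | ∀ j, |(θ j).im| < s}

/-- half-open unit box with corner `a` -/
def HBox (n : ℕ) (a : Fin n → ℝ) : Set (Fin n → ℝ) :=
  {x : Fin n → ℝ | ∀ i, x i ∈ Set.Ioc (a i) (a i + 1)}

theorem HBox_eq_pi (n : ℕ) (a : Fin n → ℝ) :
    HBox n a = Set.univ.pi fun i => Set.Ioc (a i) (a i + 1) := by
  ext x; simp [HBox]

theorem HBox_meas (n : ℕ) (a : Fin n → ℝ) : MeasurableSet (HBox n a) := by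
  rw [HBox_eq_pi]
  exact MeasurableSet.univ_pi fun i => measurableSet_Ioc

theorem HBox_vol (n : ℕ) (a : Fin n → ℝ) : volume (HBox n a) = 1 := by
  rw [HBox_eq_pi, volume_pi_pi]
  simp

instance HBox_prob (n : ℕ) (a : Fin n → ℝ) :
    IsProbabilityMeasure ((volume : Measure (Fin n → ℝ)).restrict (HBox n a)) :=
  ⟨by rw [Measure.restrict_apply_univ, HBox_vol]⟩

theorem periodic_int {n : ℕ} (g : (Fin n → ℝ) → ℂ)
    (hper : ∀ x j, g (x + Pi.single j 1) = g x) (m : Fin n → ℤ) (x : Fin n → ℝ) :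
    g (x + fun j => (m j : ℝ)) = g x := by
  let P : AddSubgroup (Fin n → ℝ) :=
    { carrier := {p | ∀ x, g (x + p) = g x}
      add_mem' := by
        intro a b ha hb x
        rw [← add_assoc, hb, ha]
      zero_mem' := by intro x; simp
      neg_mem' := by
        intro a ha x
        have := ha (x + -a)
        rw [← this]; simp }
  have h1 : ∀ j, (Pi.single j (1:ℝ) : Fin n → ℝ) ∈ P := fun j x => hper x j
  have h2 : (fun j => (m j : ℝ)) = ∑ j, m j • (Pi.single j (1:ℝ) : Fin n → ℝ) := by
    ext i
    simp [Finset.sum_apply, Pi.single_apply]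
  have h3 : (fun j => (m j : ℝ)) ∈ P := by
    rw [h2]
    exact P.sum_mem fun j _ => P.zsmul_mem (h1 j) _
  exact h3 x

theorem torus_lift {n : ℕ} (g : (Fin n → ℝ) → ℂ) (hg : Continuous g)
    (hper : ∀ x j, g (x + Pi.single j 1) = g x) :
    ∃ G : C(UnitAddTorus (Fin n), ℂ),
      ∀ x : Fin n → ℝ, G (fun j => (x j : UnitAddCircle)) = g x := by
  let π : (Fin n → ℝ) → UnitAddTorus (Fin n) := Pi.map fun _ t => (t : UnitAddCircle)
  have hq : IsOpenQuotientMap π :=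
    IsOpenQuotientMap.piMap fun _ => QuotientAddGroup.isOpenQuotientMap_mk
  let G : UnitAddTorus (Fin n) → ℂ := fun t => g (Function.surjInv hq.surjective t)
  have hG : ∀ x, G (π x) = g x := by
    intro x
    have h := Function.surjInv_eq hq.surjective (π x)
    set y := Function.surjInv hq.surjective (π x) with hy
    have h' : ∀ j, ∃ m : ℤ, y j - x j = m := by
      intro j
      have hj : ((y j : ℝ) : UnitAddCircle) = (x j : ℝ) := congrFun h j
      rw [← sub_eq_zero, ← AddCircle.coe_sub, AddCircle.coe_eq_zero_iff] at hj
      obtain ⟨m, hm⟩ := hj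
      exact ⟨m, by simpa using hm.symm⟩
    choose m hm using h'
    have : y = x + fun j => (m j : ℝ) := by
      ext j
      simp [← hm j]
    change g y = g x
    rw [this, periodic_int g hper]
  refine ⟨⟨G, ?_⟩, fun x => hG x⟩
  rw [hq.isQuotientMap.continuous_iff]
  have : G ∘ π = g := funext hG
  rw [this]; exact hg

theorem box_shift {n : ℕ} (g : (Fin n → ℝ) → ℂ) (hg : Continuous g)
    (hper : ∀ x j, g (x + Pi.single j 1) = g x) (r : Fin n → ℝ) :
    ∫ x in HBox n 0, g (x + r) = ∫ x in HBox n 0, g x := by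
  obtain ⟨G, hG⟩ := torus_lift g hg hper
  have h := (UnitAddTorus.integral_preimage (fun t => G t) r).symm.trans
    (UnitAddTorus.integral_preimage (fun t => G t) 0)
  simp only [hG] at h
  have h2 := (measurePreserving_add_right (volume : Measure (Fin n → ℝ)) r).setIntegral_preimage_emb
    (measurableEmbedding_addRight r) g (HBox n r)
  have h3 : (fun x : Fin n → ℝ => x + r) ⁻¹' HBox n r = HBox n 0 := by
    ext x
    simp only [HBox, Set.mem_preimage, Set.mem_ofPred_eq, Set.mem_Ioc, Pi.add_apply, Pi.zero_apply]
    refine forall_congr' fun i => ?_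
    constructor <;> rintro ⟨h1, h2⟩ <;> constructor <;> linarith
  rw [h3] at h2
  rw [h2]
  exact h

theorem HStrip_open (n : ℕ) (s : ℝ) : IsOpen (HStrip n s) := by
  have : HStrip n s = ⋂ j, {θ : Fin n → ℂ | |(θ j).im| < s} := by
    ext; simp [HStrip]
  rw [this]
  refine isOpen_iInter_of_finite fun j => isOpen_lt (by fun_prop) continuous_const

theorem HStrip_convex (n : ℕ) (s : ℝ) : Convex ℝ (HStrip n s) := by
  intro x hx y hy a b ha hb hab j
  have h1 := abs_lt.1 (hx j)
  have h2 := abs_lt.1 (hy j)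
  simp only [Pi.add_apply, Pi.smul_apply, Complex.add_im, Complex.smul_im, smul_eq_mul]
  obtain rfl : b = 1 - a := by linarith
  rw [abs_lt]
  rcases ha.eq_or_lt with rfl | ha
  · simpa using h2
  · constructor <;> nlinarith [mul_pos ha (sub_pos.2 h1.1), mul_pos ha (sub_pos.2 h1.2), mul_nonneg hb (sub_pos.2 h2.1).le, mul_nonneg hb (sub_pos.2 h2.2).le]

/-- the point `2πx + z` -/
noncomputable def HPt {n : ℕ} (x : Fin n → ℝ) (z : Fin n → ℂ) : Fin n → ℂ :=
  fun j => ((2 * Real.pi * x j : ℝ) : ℂ) + z j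

theorem HPt_mem {n : ℕ} {s : ℝ} (x : Fin n → ℝ) {z : Fin n → ℂ} (hz : z ∈ HStrip n s) :
    HPt x z ∈ HStrip n s := by
  intro j
  simpa [HPt, -Complex.ofReal_mul] using hz j

theorem HPt_cont {n : ℕ} : Continuous fun p : (Fin n → ℝ) × (Fin n → ℂ) => HPt p.1 p.2 := by
  unfold HPt
  fun_prop

theorem HPt_single {n : ℕ} (x : Fin n → ℝ) (z : Fin n → ℂ) (j : Fin n) :
    HPt (x + Pi.single j 1) z = HPt x z + Pi.single j (2 * Real.pi : ℂ) := by
  ext i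
  by_cases h : i = j
  · subst h; simp [HPt]; ring
  · simp [HPt, h]

theorem HPt_contx {n : ℕ} (z : Fin n → ℂ) : Continuous fun x : Fin n → ℝ => HPt x z := by
  unfold HPt
  fun_prop

theorem comp_cont {n : ℕ} {s : ℝ} {w : (Fin n → ℂ) → ℂ} (hw : DifferentiableOn ℂ w (HStrip n s))
    {z : Fin n → ℂ} (hz : z ∈ HStrip n s) : Continuous fun x : Fin n → ℝ => w (HPt x z) := by
  exact hw.continuousOn.comp_continuous (HPt_contx z) fun x => HPt_mem x hz

theorem real_shift {n : ℕ} {s : ℝ} {w : (Fin n → ℂ) → ℂ} (hw : DifferentiableOn ℂ w (HStrip n s))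
    (hper : ∀ θ ∈ HStrip n s, ∀ j, w (θ + Pi.single j (2 * Real.pi : ℂ)) = w θ)
    {z : Fin n → ℂ} (hz : z ∈ HStrip n s) (r : Fin n → ℝ) :
    ∫ x in HBox n 0, w (HPt x (z + fun j => (r j : ℂ))) = ∫ x in HBox n 0, w (HPt x z) := by
  have h := box_shift (fun x => w (HPt x z)) (comp_cont hw hz)
    (fun x j => by rw [HPt_single, hper _ (HPt_mem x hz)]) (fun j => r j / (2 * Real.pi))
  rw [← h]
  congr 1
  ext x
  congr 1
  ext j
  have : (Real.pi : ℂ) ≠ 0 := by exact_mod_cast Real.pi_ne_zero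
  simp [HPt]
  field_simp
  ring

theorem imag_shift {n : ℕ} {s : ℝ} {w : (Fin n → ℂ) → ℂ} {C : ℝ} (hs : 0 < s)
    (hw : DifferentiableOn ℂ w (HStrip n s)) (hC : ∀ θ ∈ HStrip n s, ‖w θ‖ ≤ C)
    (hper : ∀ θ ∈ HStrip n s, ∀ j, w (θ + Pi.single j (2 * Real.pi : ℂ)) = w θ)
    (y : Fin n → ℝ) (hy : ∀ j, |y j| < s) :
    ∫ x in HBox n 0, w (HPt x fun j => Complex.I * y j) = ∫ x in HBox n 0, w (HPt x 0) := by
  set Y : Fin n → ℂ := fun j => (y j : ℂ) with hY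
  set U : Set ℂ := (fun ζ : ℂ => ζ • Y) ⁻¹' HStrip n s with hU
  have hUo : IsOpen U := (HStrip_open n s).preimage (by fun_prop)
  have hUc : Convex ℝ U := by
    intro a ha b hb p q hp hq hpq
    have := HStrip_convex n s ha hb hp hq hpq
    simp only [hU, Set.mem_preimage]
    convert this using 1
    ext j
    simp
    ring
  set f : ℂ → ℂ := fun ζ => ∫ x in HBox n 0, w (HPt x (ζ • Y)) with hf
  have hline : ∀ (x : Fin n → ℝ) (ζ : ℂ), HasDerivAt (fun ζ : ℂ => HPt x (ζ • Y)) Y ζ := by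
    intro x ζ
    rw [hasDerivAt_pi]
    intro j
    simp only [HPt, Pi.smul_apply, smul_eq_mul]
    simpa using ((hasDerivAt_id ζ).mul_const (Y j)).const_add ((2 * Real.pi * x j : ℝ) : ℂ)
  have hder : ∀ (x : Fin n → ℝ) (ζ : ℂ), ζ ∈ U →
      HasDerivAt (fun ζ : ℂ => w (HPt x (ζ • Y))) (fderiv ℂ w (HPt x (ζ • Y)) Y) ζ := by
    intro x ζ hζ
    have := (hw.differentiableAt ((HStrip_open n s).mem_nhds (HPt_mem x hζ))).hasFDerivAt
    exact this.comp_hasDerivAt ζ (hline x ζ)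
  have hfd : ∀ ζ ∈ U, HasDerivAt f 0 ζ := by
    intro ζ hζ
    obtain ⟨ε, hε, hball⟩ := Metric.isOpen_iff.1 hUo ζ hζ
    have key := hasDerivAt_integral_of_dominated_loc_of_deriv_le
      (μ := (volume : Measure (Fin n → ℝ)).restrict (HBox n 0))
      (F := fun (ζ : ℂ) (x : Fin n → ℝ) => w (HPt x (ζ • Y)))
      (F' := fun (ζ : ℂ) (x : Fin n → ℝ) => fderiv ℂ w (HPt x (ζ • Y)) Y)
      (x₀ := ζ) (s := Metric.ball ζ (ε / 2)) (bound := fun _ => C / (ε / 4))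
      (Metric.ball_mem_nhds _ (by positivity))
      (by
        filter_upwards [hUo.mem_nhds hζ] with ξ hξ
        exact (comp_cont hw hξ).aestronglyMeasurable)
      (by
        refine Integrable.of_bound (comp_cont hw hζ).aestronglyMeasurable C ?_
        exact Filter.Eventually.of_forall fun x => hC _ (HPt_mem x hζ))
      (by
        refine Measurable.aestronglyMeasurable ?_
        exact (measurable_fderiv_apply_const ℂ w Y).comp (HPt_contx _).measurable)
      (by
        refine Filter.Eventually.of_forall fun x ξ hξ => ?_
        have hsub : Metric.closedBall ξ (ε / 4) ⊆ U := by
          intro η hη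
          apply hball
          rw [Metric.mem_ball] at *
          rw [Metric.mem_closedBall] at hη
          have := dist_triangle η ξ ζ
          linarith
        have hξU : ξ ∈ U := hsub (Metric.mem_closedBall_self (by positivity))
        rw [← (hder x ξ hξU).deriv]
        refine Complex.norm_deriv_le_of_forall_mem_sphere_norm_le (by positivity) ?_ ?_
        · refine DifferentiableOn.diffContOnCl ?_
          rw [closure_ball _ (by positivity)]
          intro η hη
          exact (hder x η (hsub hη)).differentiableAt.differentiableWithinAt
        · intro η hη
          exact hC _ (HPt_mem x (hsub (Metric.sphere_subset_closedBall hη))))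
      (integrable_const _)
      (by
        refine Filter.Eventually.of_forall fun x ξ hξ => hder x ξ (hball ?_)
        exact Metric.ball_subset_ball (by linarith) hξ)
    have hD := key.2
    set D := ∫ x in HBox n 0, fderiv ℂ w (HPt x (ζ • Y)) Y
    have hconst : ∀ t : ℝ, f (ζ + t) = f ζ := by
      intro t
      have := real_shift hw hper hζ (fun j => t * y j)
      simp only [hf]
      rw [← this]
      congr 1
      ext x
      congr 2
      ext j
      simp [hY]; ring
    have h1 : HasDerivAt (fun t : ℝ => f (ζ + t)) D 0 := by
      have hD' : HasDerivAt f D (ζ + ((0:ℝ) : ℂ)) := by simpa using hD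
      have h3 : HasDerivAt (fun t : ℝ => ζ + (t : ℂ)) 1 0 := by
        simpa using (Complex.ofRealCLM.hasDerivAt (x := (0:ℝ))).const_add ζ
      have h4 := hD'.comp (0:ℝ) h3
      rw [mul_one] at h4
      exact h4
    simp only [hconst] at h1
    have h2 := h1.unique (hasDerivAt_const (0:ℝ) (f ζ))
    rw [← h2]
    exact hD
  have h0 : (0 : ℂ) ∈ U := by
    intro j; simpa using hs
  have hI : Complex.I ∈ U := by
    intro j; simpa [hY] using hy j
  have := hUo.is_const_of_deriv_eq_zero hUc.isPreconnected
    (fun ζ hζ => (hfd ζ hζ).differentiableAt.differentiableWithinAt)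
    (fun ζ hζ => (hfd ζ hζ).deriv) hI h0
  simp only [hf, zero_smul] at this
  exact this

/-- `|k|₁` -/
def HAbs {n : ℕ} (k : Fin n → ℤ) : ℝ := ∑ j, |(k j : ℝ)|

theorem HAbs_nonneg {n : ℕ} (k : Fin n → ℤ) : 0 ≤ HAbs k :=
  Finset.sum_nonneg fun _ _ => abs_nonneg _

theorem HAbs_zero {n : ℕ} : HAbs (0 : Fin n → ℤ) = 0 := by simp [HAbs]

theorem HAbs_one_le {n : ℕ} {k : Fin n → ℤ} (hk : k ≠ 0) : 1 ≤ HAbs k := by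
  obtain ⟨j, hj⟩ := Function.ne_iff.1 hk
  have h1 : (1:ℝ) ≤ |(k j : ℝ)| := by
    exact_mod_cast Int.one_le_abs hj
  exact h1.trans (Finset.single_le_sum (f := fun j => |(k j : ℝ)|) (fun _ _ => abs_nonneg _)
    (Finset.mem_univ j))

/-- the pairing `⟨k, θ⟩` -/
noncomputable def HPair {n : ℕ} (k : Fin n → ℤ) (θ : Fin n → ℂ) : ℂ := ∑ j, (k j : ℂ) * θ j

theorem HPair_add {n : ℕ} (k : Fin n → ℤ) (θ η : Fin n → ℂ) :
    HPair k (θ + η) = HPair k θ + HPair k η := by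
  simp [HPair, mul_add, Finset.sum_add_distrib]

theorem HPair_im {n : ℕ} (k : Fin n → ℤ) (θ : Fin n → ℂ) :
    (HPair k θ).im = ∑ j, (k j : ℝ) * (θ j).im := by
  simp [HPair]

theorem HPair_im_bound {n : ℕ} (k : Fin n → ℤ) (θ : Fin n → ℂ) {s : ℝ} (h : ∀ j, |(θ j).im| ≤ s) :
    |(HPair k θ).im| ≤ s * HAbs k := by
  rw [HPair_im, HAbs, Finset.mul_sum]
  refine (Finset.abs_sum_le_sum_abs _ _).trans (Finset.sum_le_sum fun j _ => ?_)
  rw [abs_mul, mul_comm]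
  exact mul_le_mul_of_nonneg_right (h j) (abs_nonneg _)

/-- the character `exp(i⟨k, θ⟩)` -/
noncomputable def HChar {n : ℕ} (k : Fin n → ℤ) (θ : Fin n → ℂ) : ℂ :=
  Complex.exp (Complex.I * HPair k θ)

theorem HChar_norm {n : ℕ} (k : Fin n → ℤ) (θ : Fin n → ℂ) :
    ‖HChar k θ‖ = Real.exp (-(HPair k θ).im) := by
  rw [HChar, Complex.norm_exp]; simp

theorem HChar_add {n : ℕ} (k : Fin n → ℤ) (θ η : Fin n → ℂ) :
    HChar k (θ + η) = HChar k θ * HChar k η := by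
  rw [HChar, HPair_add, mul_add, Complex.exp_add]; rfl

theorem HChar_zero {n : ℕ} (θ : Fin n → ℂ) : HChar 0 θ = 1 := by
  simp [HChar, HPair]

theorem HChar_neg {n : ℕ} (k : Fin n → ℤ) (θ : Fin n → ℂ) :
    HChar (-k) θ * HChar k θ = 1 := by
  rw [HChar, HChar, ← Complex.exp_add]
  simp [HPair]

theorem HChar_per {n : ℕ} (k : Fin n → ℤ) (θ : Fin n → ℂ) (j : Fin n) :
    HChar k (θ + Pi.single j (2 * Real.pi : ℂ)) = HChar k θ := by
  rw [HChar_add]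
  have : HChar k (Pi.single j (2 * Real.pi : ℂ)) = 1 := by
    rw [HChar, Complex.exp_eq_one_iff]
    refine ⟨k j, ?_⟩
    simp [HPair, Pi.single_apply]
    ring
  rw [this, mul_one]

theorem HChar_norm_le {n : ℕ} (k : Fin n → ℤ) (θ : Fin n → ℂ) {s : ℝ} (h : ∀ j, |(θ j).im| ≤ s) :
    ‖HChar k θ‖ ≤ Real.exp (s * HAbs k) := by
  rw [HChar_norm]
  have := abs_le.1 (HPair_im_bound k θ h)
  exact Real.exp_le_exp.2 (by linarith)

/-- the differential of `⟨k, θ⟩` -/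
noncomputable def HPairL {n : ℕ} (k : Fin n → ℤ) : (Fin n → ℂ) →L[ℂ] ℂ :=
  ∑ j, (k j : ℂ) • ContinuousLinearMap.proj j

theorem HPairL_apply {n : ℕ} (k : Fin n → ℤ) (θ : Fin n → ℂ) : HPairL k θ = HPair k θ := by
  simp [HPairL, HPair]

theorem HPairL_norm {n : ℕ} (k : Fin n → ℤ) : ‖HPairL k‖ ≤ HAbs k := by
  refine ContinuousLinearMap.opNorm_le_bound _ (HAbs_nonneg k) fun θ => ?_
  rw [HPairL_apply, HPair, HAbs, Finset.sum_mul]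
  refine (norm_sum_le _ _).trans (Finset.sum_le_sum fun j _ => ?_)
  rw [norm_mul, Complex.norm_intCast]
  exact mul_le_mul_of_nonneg_left (norm_le_pi_norm θ j) (abs_nonneg _)

theorem HChar_deriv {n : ℕ} (k : Fin n → ℤ) (θ : Fin n → ℂ) :
    HasFDerivAt (HChar k) ((HChar k θ * Complex.I) • HPairL k) θ := by
  have h : HasFDerivAt (fun θ => Complex.I * HPair k θ) (Complex.I • HPairL k) θ := by
    have := ((HPairL k).hasFDerivAt (x := θ)).const_mul Complex.I
    simpa only [HPairL_apply] using this
  have h2 := h.cexp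
  rw [smul_smul] at h2
  exact h2

theorem HChar_mFourier {n : ℕ} (k : Fin n → ℤ) (x : Fin n → ℝ) :
    UnitAddTorus.mFourier k (fun j => (x j : UnitAddCircle)) = HChar k (HPt x 0) := by
  simp only [UnitAddTorus.mFourier, ContinuousMap.coe_mk, fourier_coe_apply, HChar]
  rw [← Complex.exp_sum]
  congr 1
  simp only [HPair, HPt, Finset.mul_sum]
  refine Finset.sum_congr rfl fun j _ => ?_
  push_cast
  simp
  ring

theorem exp_sum_int (a : ℝ) (ha : 0 < a) (T : Finset ℤ) :
    ∑ k ∈ T, Real.exp (-a * |(k : ℝ)|) ≤ 1 + 2 / a := by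
  set r := Real.exp (-a) with hr
  have hr0 : 0 < r := Real.exp_pos _
  have hr1 : r < 1 := by rw [hr, Real.exp_lt_one_iff]; linarith
  have h1 := hasSum_geometric_of_lt_one hr0.le hr1
  have h2 := h1.mul_left r
  have h3 : HasSum (fun k : ℤ => Real.exp (-a * |(k : ℝ)|)) ((1 - r)⁻¹ + r * (1 - r)⁻¹) := by
    refine HasSum.of_nat_of_neg_add_one ?_ ?_
    · refine HasSum.congr_fun h1 fun m => ?_
      rw [hr, ← Real.exp_nat_mul]
      congr 1; simp; ring
    · refine HasSum.congr_fun h2 fun m => ?_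
      rw [hr, ← Real.exp_nat_mul, ← Real.exp_add]
      congr 1
      push_cast
      rw [abs_neg, abs_of_nonneg (by positivity)]; ring
  have h4 := sum_le_hasSum T (fun i _ => (Real.exp_pos _).le) h3
  refine h4.trans ?_
  have h5 : 0 < 1 - r := by linarith
  have h6 : r * (1 + a) ≤ 1 := by
    have := Real.add_one_le_exp a
    calc r * (1 + a) ≤ r * Real.exp a := by gcongr; linarith
      _ = 1 := by rw [hr, ← Real.exp_add]; simp
  have : (1 - r)⁻¹ + r * (1 - r)⁻¹ = (1 + r) / (1 - r) := by field_simp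
  rw [this, div_le_iff₀ h5]
  have : (1 + 2 / a) * (1 - r) = ((a + 2) * (1 - r)) / a := by field_simp
  rw [this, le_div_iff₀ ha]
  nlinarith

theorem exp_sum_fin {n : ℕ} (a : ℝ) (ha : 0 < a) (T : Finset (Fin n → ℤ)) :
    ∑ k ∈ T, Real.exp (-a * HAbs k) ≤ (1 + 2 / a) ^ n := by
  classical
  let S : Finset ℤ := Finset.univ.biUnion fun j => T.image fun k => k j
  have hsub : T ⊆ Fintype.piFinset fun _ => S := by
    intro k hk
    rw [Fintype.mem_piFinset]
    intro j
    simp only [S, Finset.mem_biUnion, Finset.mem_univ, true_and, Finset.mem_image]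
    exact ⟨j, k, hk, rfl⟩
  calc ∑ k ∈ T, Real.exp (-a * HAbs k)
      ≤ ∑ k ∈ Fintype.piFinset fun _ => S, Real.exp (-a * HAbs k) :=
        Finset.sum_le_sum_of_subset_of_nonneg hsub fun _ _ _ => (Real.exp_pos _).le
    _ = ∑ k ∈ Fintype.piFinset fun _ : Fin n => S, ∏ j, Real.exp (-a * |(k j : ℝ)|) := by
        refine Finset.sum_congr rfl fun k _ => ?_
        rw [← Real.exp_sum, HAbs, Finset.mul_sum]
    _ = ∏ _j : Fin n, ∑ m ∈ S, Real.exp (-a * |(m : ℝ)|) := by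
        rw [Finset.prod_univ_sum]
    _ ≤ ∏ _j : Fin n, (1 + 2 / a) := by
        refine Finset.prod_le_prod (fun _ _ => Finset.sum_nonneg fun _ _ => (Real.exp_pos _).le)
          fun _ _ => exp_sum_int a ha S
    _ = _ := by simp

theorem exp_summable {n : ℕ} (a : ℝ) (ha : 0 < a) :
    Summable fun k : Fin n → ℤ => Real.exp (-a * HAbs k) :=
  summable_of_sum_le (fun _ => (Real.exp_pos _).le) (exp_sum_fin a ha)

theorem exp_tsum_le {n : ℕ} (a : ℝ) (ha : 0 < a) :
    ∑' k : Fin n → ℤ, Real.exp (-a * HAbs k) ≤ (1 + 2 / a) ^ n :=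
  Real.tsum_le_of_sum_le (fun _ => (Real.exp_pos _).le) (exp_sum_fin a ha)

/-- Fourier coefficient -/
noncomputable def HCoef {n : ℕ} (v : (Fin n → ℂ) → ℂ) (k : Fin n → ℤ) : ℂ :=
  ∫ x in HBox n 0, v (HPt x 0) * HChar (-k) (HPt x 0)

theorem HCoef_shift_aux {n : ℕ} {s : ℝ} {v : (Fin n → ℂ) → ℂ} {B : ℝ} (hs : 0 < s)
    (hv : DifferentiableOn ℂ v (HStrip n s)) (hB : ∀ θ ∈ HStrip n s, ‖v θ‖ ≤ B)
    (hper : ∀ θ ∈ HStrip n s, ∀ j, v (θ + Pi.single j (2 * Real.pi : ℂ)) = v θ)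
    (k : Fin n → ℤ) (y : Fin n → ℝ) (hy : ∀ j, |y j| < s) :
    ∫ x in HBox n 0, v (HPt x fun j => Complex.I * y j) *
      HChar (-k) (HPt x fun j => Complex.I * y j) = HCoef v k := by
  refine imag_shift (w := fun θ => v θ * HChar (-k) θ) (C := B * Real.exp (s * HAbs (-k)))
    hs ?_ ?_ ?_ y hy
  · exact hv.mul fun θ _ => (HChar_deriv _ θ).differentiableAt.differentiableWithinAt
  · intro θ hθ
    rw [norm_mul]
    exact mul_le_mul (hB θ hθ) (HChar_norm_le _ _ fun j => (hθ j).le) (norm_nonneg _)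
      ((norm_nonneg _).trans (hB θ hθ))
  · intro θ hθ j
    simp only [hper θ hθ, HChar_per]

theorem HPt_split {n : ℕ} (x : Fin n → ℝ) (z : Fin n → ℂ) : HPt x z = HPt x 0 + z := by
  ext j; simp [HPt]

theorem HPt_im {n : ℕ} (x : Fin n → ℝ) (z : Fin n → ℂ) (j : Fin n) :
    (HPt x z j).im = (z j).im := by
  simp [HPt, -Complex.ofReal_mul]

theorem HCoef_bound {n : ℕ} {s : ℝ} {v : (Fin n → ℂ) → ℂ} {B : ℝ} (hs : 0 < s)
    (hv : DifferentiableOn ℂ v (HStrip n s)) (hB : ∀ θ ∈ HStrip n s, ‖v θ‖ ≤ B)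
    (hper : ∀ θ ∈ HStrip n s, ∀ j, v (θ + Pi.single j (2 * Real.pi : ℂ)) = v θ)
    (k : Fin n → ℤ) : ‖HCoef v k‖ ≤ B * Real.exp (-s * HAbs k) := by
  have main : ∀ t ∈ Set.Ioo 0 s, ‖HCoef v k‖ ≤ B * Real.exp (-t * HAbs k) := by
    intro t ht
    let y : Fin n → ℝ := fun j => -t * (SignType.sign (k j : ℝ) : ℝ)
    have hy : ∀ j, |y j| < s := by
      intro j
      refine lt_of_le_of_lt ?_ ht.2
      simp only [y, abs_mul, abs_neg, abs_of_pos ht.1]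
      rcases lt_trichotomy (k j : ℝ) 0 with h | h | h
      · simp [sign_neg h]
      · simp [h, ht.1.le]
      · simp [sign_pos h]
    have hmem : (fun j => Complex.I * (y j : ℂ)) ∈ HStrip n s := by
      intro j; simpa using hy j
    rw [← HCoef_shift_aux hs hv hB hper k y hy]
    have := norm_setIntegral_le_of_norm_le_const (μ := volume) (s := HBox n 0)
      (f := fun x => v (HPt x fun j => Complex.I * y j) *
      HChar (-k) (HPt x fun j => Complex.I * y j)) (C := B * Real.exp (-t * HAbs k))
      (by simp [HBox_vol]) (fun x _ => by
        rw [norm_mul]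
        refine mul_le_mul (hB _ (HPt_mem x hmem)) ?_ (norm_nonneg _)
          ((norm_nonneg _).trans (hB _ (HPt_mem x hmem)))
        rw [HChar_norm, HPair_im]
        simp only [HPt_im]
        apply le_of_eq
        congr 1
        rw [HAbs, Finset.mul_sum, ← Finset.sum_neg_distrib]
        refine Finset.sum_congr rfl fun j _ => ?_
        have him : (Complex.I * (y j : ℂ)).im = y j := by simp
        rw [him, ← self_mul_sign]
        simp only [Pi.neg_apply, Int.cast_neg, y]
        ring)
    simpa [Measure.real, HBox_vol] using this
  have hcl : s ∈ closure (Set.Ioo 0 s) := by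
    rw [closure_Ioo hs.ne]; exact ⟨hs.le, le_rfl⟩
  refine closure_minimal (s := Set.Ioo 0 s) (t := {t | ‖HCoef v k‖ ≤ B * Real.exp (-t * HAbs k)})
    main ?_ hcl
  exact isClosed_le continuous_const (by fun_prop)

theorem HFourier {n : ℕ} {s : ℝ} {v : (Fin n → ℂ) → ℂ} {B : ℝ} (hs : 0 < s)
    (hv : DifferentiableOn ℂ v (HStrip n s)) (hB : ∀ θ ∈ HStrip n s, ‖v θ‖ ≤ B)
    (hper : ∀ θ ∈ HStrip n s, ∀ j, v (θ + Pi.single j (2 * Real.pi : ℂ)) = v θ)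
    (θ : Fin n → ℂ) (hθ : θ ∈ HStrip n s) :
    HasSum (fun k => HCoef v k * HChar k θ) (v θ) := by
  set y : Fin n → ℝ := fun j => (θ j).im with hy
  set z : Fin n → ℂ := fun j => Complex.I * y j with hz
  have hzm : z ∈ HStrip n s := by
    intro j; simpa [hz] using hθ j
  set x₀ : Fin n → ℝ := fun j => (θ j).re / (2 * Real.pi) with hx₀
  have hθeq : θ = HPt x₀ z := by
    ext j
    simp only [HPt, hx₀, hz, hy]
    rw [mul_div_cancel₀ _ (by positivity), mul_comm, Complex.re_add_im]
  obtain ⟨G, hG⟩ := torus_lift (fun x => v (HPt x z)) (comp_cont hv hzm)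
    (fun x j => by rw [HPt_single, hper _ (HPt_mem x hzm)])
  have hcoef : ∀ k, UnitAddTorus.mFourierCoeff G k = HCoef v k * HChar k z := by
    intro k
    rw [UnitAddTorus.mFourierCoeff_eq_integral G k 0, ← HCoef_shift_aux hs hv hB hper k y hθ,
      ← integral_mul_const]
    change ∫ x in HBox n 0, _ = _
    congr 1
    ext x
    rw [HChar_mFourier, hG, HPt_split x (fun j => Complex.I * y j), HChar_add, smul_eq_mul]
    change _ = _ * (_ * HChar (-k) z) * _
    rw [mul_assoc, mul_assoc, HChar_neg, mul_one, ← HPt_split, mul_comm]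
  have hsum : Summable (UnitAddTorus.mFourierCoeff G) := by
    obtain ⟨t, ht, hlt⟩ : ∃ t < s, ∀ j, |(z j).im| ≤ t := by
      by_cases hn : Nonempty (Fin n)
      · obtain ⟨j, hj⟩ := Finite.exists_max fun j => |(z j).im|
        exact ⟨_, hzm j, hj⟩
      · exact ⟨0, hs, fun j => (hn ⟨j⟩).elim⟩
    refine Summable.of_norm_bounded ((exp_summable (n := n) (s - t) (by linarith)).mul_left B) ?_
    intro k
    rw [hcoef, norm_mul]
    have h0 : 0 ≤ B := (norm_nonneg _).trans (hB _ hθ)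
    calc _ ≤ (B * Real.exp (-s * HAbs k)) * Real.exp (t * HAbs k) :=
          mul_le_mul (HCoef_bound hs hv hB hper k) (HChar_norm_le k z hlt) (norm_nonneg _)
            (by positivity)
      _ = _ := by rw [mul_assoc, ← Real.exp_add]; congr 2; ring
  have h := UnitAddTorus.hasSum_mFourier_series_apply_of_summable hsum (fun j => (x₀ j : UnitAddCircle))
  rw [hG, ← hθeq] at h
  convert h using 2 with k
  rw [hcoef, HChar_mFourier, hθeq, HPt_split, HChar_add, smul_eq_mul]
  ring

theorem rpow_exp_bound (p : ℝ) (hp : 0 ≤ p) :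
    ∃ D : ℝ, 0 < D ∧ ∀ x : ℝ, 0 ≤ x → x ^ p * Real.exp (-x) ≤ D := by
  obtain ⟨m, hm⟩ := exists_nat_ge p
  have hf : (1:ℝ) ≤ (m.factorial : ℝ) := by exact_mod_cast Nat.factorial_pos m
  refine ⟨m.factorial, by positivity, fun x hx => ?_⟩
  rcases le_total x 1 with h | h
  · have h1 : x ^ p ≤ 1 := Real.rpow_le_one hx h hp
    have h2 : Real.exp (-x) ≤ 1 := Real.exp_le_one_iff.2 (by linarith)
    calc x ^ p * Real.exp (-x) ≤ 1 * 1 := mul_le_mul h1 h2 (Real.exp_pos _).le zero_le_one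
      _ ≤ _ := by simpa using hf
  · have h1 : x ^ p ≤ x ^ m := by
      rw [← Real.rpow_natCast]
      exact Real.rpow_le_rpow_of_exponent_le h hm
    have h2 := Real.pow_div_factorial_le_exp x hx m
    rw [div_le_iff₀ (by positivity)] at h2
    rw [Real.exp_neg, ← div_eq_mul_inv, div_le_iff₀ (Real.exp_pos _)]
    linarith

theorem rpow_exp_bound2 (p : ℝ) (hp : 0 ≤ p) :
    ∃ D : ℝ, 0 < D ∧ ∀ σ x : ℝ, 0 < σ → 0 ≤ x →
      x ^ p * Real.exp (-σ * x) ≤ D * (2 / σ) ^ p * Real.exp (-(σ / 2) * x) := by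
  obtain ⟨D, hD, h⟩ := rpow_exp_bound p hp
  refine ⟨D, hD, fun σ x hσ hx => ?_⟩
  have h1 := h (σ / 2 * x) (by positivity)
  have h2 : x ^ p = (2 / σ) ^ p * (σ / 2 * x) ^ p := by
    rw [← Real.mul_rpow (by positivity) (by positivity)]
    congr 1; field_simp
  have h3 : Real.exp (-σ * x) = Real.exp (-(σ / 2 * x)) * Real.exp (-(σ / 2) * x) := by
    rw [← Real.exp_add]; congr 1; ring
  rw [h2, h3]
  calc _ = ((σ / 2 * x) ^ p * Real.exp (-(σ / 2 * x))) * ((2 / σ) ^ p * Real.exp (-(σ / 2) * x)) := by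
        ring
    _ ≤ D * ((2 / σ) ^ p * Real.exp (-(σ / 2) * x)) := by gcongr
    _ = _ := by ring

theorem poly_summable {n : ℕ} (p : ℝ) (hp : 0 ≤ p) (σ : ℝ) (hσ : 0 < σ) :
    Summable fun k : Fin n → ℤ => HAbs k ^ p * Real.exp (-σ * HAbs k) := by
  obtain ⟨D, hD, h⟩ := rpow_exp_bound2 p hp
  refine Summable.of_nonneg_of_le (fun k => ?_) (fun k => h σ (HAbs k) hσ (HAbs_nonneg k))
    ((exp_summable (n := n) (σ / 2) (by positivity)).mul_left _)
  have := HAbs_nonneg k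
  positivity

theorem poly_tsum_bound (n : ℕ) (τ : ℝ) (hτ : 0 < τ) :
    ∃ c : ℝ, 0 < c ∧ ∀ σ : ℝ, 0 < σ →
      ∑' k : Fin n → ℤ, HAbs k ^ τ * Real.exp (-σ * HAbs k) ≤ c / σ ^ (τ + (n : ℝ)) := by
  obtain ⟨D, hD, h⟩ := rpow_exp_bound2 τ hτ.le
  obtain ⟨D', hD', h'⟩ := rpow_exp_bound n (by positivity)
  refine ⟨D * 2 ^ τ * (4 ^ n * Real.exp 2 * D'), by positivity, fun σ hσ => ?_⟩
  have hterm : ∀ k : Fin n → ℤ, HAbs k ^ τ * Real.exp (-σ * HAbs k) ≤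
      (D * (2 / σ) ^ τ * Real.exp (-(σ / 4))) * Real.exp (-(σ / 4) * HAbs k) := by
    intro k
    by_cases hk : k = 0
    · rw [hk, HAbs_zero, Real.zero_rpow hτ.ne']
      simp only [zero_mul]
      positivity
    · refine (h σ (HAbs k) hσ (HAbs_nonneg k)).trans ?_
      rw [mul_assoc _ (Real.exp _), ← Real.exp_add]
      have := HAbs_one_le hk
      gcongr
      nlinarith
  have h1 := (poly_summable (n := n) τ hτ.le σ hσ).tsum_le_tsum hterm
    ((exp_summable (n := n) (σ / 4) (by positivity)).mul_left _)
  rw [tsum_mul_left] at h1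
  refine h1.trans ?_
  have h2 := exp_tsum_le (n := n) (σ / 4) (by positivity)
  have h3 : Real.exp (-(σ / 4)) * (1 + 2 / (σ / 4)) ^ n ≤ (4 ^ n * Real.exp 2 * D') / σ ^ n := by
    have h4 := h' ((σ + 8) / 4) (by positivity)
    rw [Real.rpow_natCast] at h4
    have h5 : (1 + 2 / (σ / 4)) ^ n = 4 ^ n * ((σ + 8) / 4) ^ n / σ ^ n := by
      rw [← mul_pow, ← div_pow]; congr 1; field_simp; ring
    have h6 : Real.exp (-(σ / 4)) = Real.exp 2 * Real.exp (-((σ + 8) / 4)) := by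
      rw [← Real.exp_add]; congr 1; ring
    rw [h5, h6, mul_div_assoc']
    refine div_le_div_of_nonneg_right ?_ (by positivity)
    calc _ = 4 ^ n * Real.exp 2 * (((σ + 8) / 4) ^ n * Real.exp (-((σ + 8) / 4))) := by ring
      _ ≤ _ := by gcongr
  calc _ ≤ (D * (2 / σ) ^ τ * Real.exp (-(σ / 4))) * (1 + 2 / (σ / 4)) ^ n := by gcongr
    _ = D * (2 / σ) ^ τ * (Real.exp (-(σ / 4)) * (1 + 2 / (σ / 4)) ^ n) := by ring
    _ ≤ D * (2 / σ) ^ τ * ((4 ^ n * Real.exp 2 * D') / σ ^ n) := by gcongr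
    _ = _ := by
      rw [Real.rpow_add hσ, Real.rpow_natCast, Real.div_rpow (by norm_num) hσ.le]
      field_simp

open scoped Pointwise in
theorem mean_eq {n : ℕ} (f : (Fin n → ℂ) → ℂ) :
    (∫ x in Set.univ.pi fun _ : Fin n => Set.Icc (0 : ℝ) (2 * Real.pi), f (fun j => (x j : ℂ))) =
      ((2 * Real.pi) ^ n : ℝ) • ∫ x in HBox n 0, f (HPt x 0) := by
  have hpi : 0 < 2 * Real.pi := by positivity
  have h := Measure.setIntegral_comp_smul_of_pos (volume : Measure (Fin n → ℝ))
    (fun x => f (fun j => (x j : ℂ))) (HBox n 0) hpi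
  have h1 : (∫ x in HBox n 0, f (HPt x 0)) =
      ∫ x in HBox n 0, f (fun j => (((2 * Real.pi) • x) j : ℂ)) := by
    congr 1
    ext x
    congr 1
    ext j
    simp [HPt]
  have h2 : (2 * Real.pi) • HBox n 0 = Set.univ.pi fun _ : Fin n => Set.Ioc (0:ℝ) (2 * Real.pi) := by
    ext x
    rw [Set.mem_smul_set_iff_inv_smul_mem₀ hpi.ne']
    simp only [HBox, Set.mem_ofPred_eq, Set.mem_pi, Set.mem_univ, true_imp_iff, Set.mem_Ioc,
      Pi.smul_apply, smul_eq_mul, Pi.zero_apply, zero_add]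
    refine forall_congr' fun i => ?_
    rw [inv_mul_le_iff₀ hpi, mul_one]
    refine and_congr ?_ Iff.rfl
    rw [mul_pos_iff_of_pos_left (inv_pos.2 hpi)]
  rw [h1, h, h2, smul_smul, Module.finrank_fin_fun, mul_inv_cancel₀ (by positivity), one_smul]
  symm
  refine setIntegral_congr_set ?_
  rw [Set.pi_univ_Icc (fun _ : Fin n => (0:ℝ)) (fun _ => 2 * Real.pi)]
  exact Measure.univ_pi_Ioc_ae_eq_Icc

theorem coef_zero {n : ℕ} (f : (Fin n → ℂ) → ℂ) : HCoef f 0 = ∫ x in HBox n 0, f (HPt x 0) := by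
  simp [HCoef, HChar_zero]

theorem coef_zero_of_mean {n : ℕ} (f : (Fin n → ℂ) → ℂ)
    (h : (∫ x in Set.univ.pi fun _ : Fin n => Set.Icc (0 : ℝ) (2 * Real.pi),
      f (fun j => (x j : ℂ))) = 0) : ∫ x in HBox n 0, f (HPt x 0) = 0 := by
  rw [mean_eq, smul_eq_zero] at h
  exact h.resolve_left (by positivity)

theorem sum_fderiv {n : ℕ} (ω : Fin n → ℝ) (L : (Fin n → ℂ) →L[ℂ] ℂ) :
    ∑ j, (ω j : ℂ) * L (Pi.single j 1) = L (fun j => (ω j : ℂ)) := by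
  conv_rhs => rw [← Finset.univ_sum_single (fun j => (ω j : ℂ)), map_sum]
  refine Finset.sum_congr rfl fun j _ => ?_
  rw [← smul_eq_mul, ← map_smul]
  congr 1
  rw [← Pi.single_smul]; simp

theorem HPair_real {n : ℕ} (k : Fin n → ℤ) (ω : Fin n → ℝ) :
    HPair k (fun j => (ω j : ℂ)) = ((∑ j, (k j : ℝ) * ω j : ℝ) : ℂ) := by
  simp [HPair]

theorem zero_mem_HStrip {n : ℕ} {s : ℝ} (hs : 0 < s) : (0 : Fin n → ℂ) ∈ HStrip n s := by
  intro j; simpa using hs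

theorem uniq_aux {n : ℕ} {s : ℝ} {w : (Fin n → ℂ) → ℂ} {C : ℝ} (hs : 0 < s)
    (hw : DifferentiableOn ℂ w (HStrip n s)) (hC : ∀ θ ∈ HStrip n s, ‖w θ‖ ≤ C)
    (hper : ∀ θ ∈ HStrip n s, ∀ j, w (θ + Pi.single j (2 * Real.pi : ℂ)) = w θ)
    (ω : Fin n → ℝ) (hω : ∀ k : Fin n → ℤ, k ≠ 0 → (∑ j, (k j : ℝ) * ω j) ≠ 0)
    (hmean : ∫ x in HBox n 0, w (HPt x 0) = 0)
    (hD : ∀ θ ∈ HStrip n s, fderiv ℂ w θ (fun j => (ω j : ℂ)) = 0) :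
    ∀ θ ∈ HStrip n s, w θ = 0 := by
  set W : Fin n → ℂ := fun j => (ω j : ℂ) with hW
  have hline : ∀ θ ∈ HStrip n s, ∀ t : ℝ, w (θ + t • W) = w θ := by
    intro θ hθ t
    have hmem : ∀ t : ℝ, θ + t • W ∈ HStrip n s := by
      intro t j
      simpa [hW] using hθ j
    have hd : ∀ t : ℝ, HasDerivAt (fun t : ℝ => w (θ + t • W)) 0 t := by
      intro t
      have h1 := ((hw.differentiableAt ((HStrip_open n s).mem_nhds (hmem t))).hasFDerivAt).restrictScalars ℝ
      have h2 : HasDerivAt (fun t : ℝ => θ + t • W) W t := by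
        simpa using ((hasDerivAt_id t).smul_const W).const_add θ
      have h3 := h1.comp_hasDerivAt t h2
      have h4 : (ContinuousLinearMap.restrictScalars ℝ (fderiv ℂ w (θ + t • W))) W = 0 := hD _ (hmem t)
      rw [h4] at h3
      exact h3
    have := is_const_of_deriv_eq_zero (fun t => (hd t).differentiableAt) (fun t => (hd t).deriv) t 0
    simpa using this
  have hcoef : ∀ k, HCoef w k = 0 := by
    intro k
    by_cases hk : k = 0
    · rw [hk, coef_zero, hmean]
    · set q := ∑ j, (k j : ℝ) * ω j with hq
      have hq0 : q ≠ 0 := hω k hk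
      have h := real_shift (w := fun θ => w θ * HChar (-k) θ)
        (hw.mul fun θ _ => (HChar_deriv _ θ).differentiableAt.differentiableWithinAt)
        (by intro θ hθ j; simp only [hper θ hθ, HChar_per])
        (zero_mem_HStrip hs) (fun j => Real.pi / q * ω j)
      have hc : HChar (-k) ((Real.pi / q) • W) = -1 := by
        have h1 : HPair (-k) ((Real.pi / q) • W) = -(Real.pi : ℂ) := by
          have : (Real.pi / q) • W = fun j => ((Real.pi / q * ω j : ℝ) : ℂ) := by
            ext j; simp [hW]
          rw [this, HPair_real, ← Complex.ofReal_neg]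
          congr 1
          have : ∑ j, (((-k) j : ℤ) : ℝ) * (Real.pi / q * ω j) = -(Real.pi / q) * q := by
            rw [hq, Finset.mul_sum]
            refine Finset.sum_congr rfl fun j _ => ?_
            rw [← hq]
            simp; ring
          rw [this]; field_simp
        rw [HChar, h1, mul_neg, Complex.exp_neg, mul_comm, Complex.exp_pi_mul_I]
        norm_num
      have h2 : ∀ x : Fin n → ℝ, HPt x (0 + fun j => ((Real.pi / q * ω j : ℝ) : ℂ)) =
          HPt x 0 + (Real.pi / q) • W := by
        intro x
        rw [zero_add, HPt_split]
        congr 1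
        ext j; simp [hW]
      simp only [h2] at h
      have h3 : ∀ x : Fin n → ℝ, w (HPt x 0 + (Real.pi / q) • W) *
          HChar (-k) (HPt x 0 + (Real.pi / q) • W) = -(w (HPt x 0) * HChar (-k) (HPt x 0)) := by
        intro x
        rw [hline _ (HPt_mem x (zero_mem_HStrip hs)), HChar_add, hc]
        ring
      simp only [h3] at h
      rw [integral_neg] at h
      change -HCoef w k = HCoef w k at h
      exact self_eq_neg.1 h.symm
  intro θ hθ
  have h := HFourier hs hw hC hper θ hθ
  simp only [hcoef, zero_mul] at h
  exact h.unique hasSum_zero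

theorem apply_hasSum {n : ℕ} {ι : Type} {L : ι → ((Fin n → ℂ) →L[ℂ] ℂ)}
    {M : (Fin n → ℂ) →L[ℂ] ℂ} (h : HasSum L M) (W : Fin n → ℂ) :
    HasSum (fun k => L k W) (M W) := by
  have := (ContinuousLinearMap.apply ℂ ℂ W).hasSum h
  exact this

set_option maxHeartbeats 1000000 in
theorem exist_aux {n : ℕ} {τ : ℝ} (hτ : 0 < τ) {α : ℝ} (hα : 0 < α) (ω : Fin n → ℝ)
    (hω : ∀ k : Fin n → ℤ, k ≠ 0 → α / HAbs k ^ τ ≤ |∑ j, (k j : ℝ) * ω j|)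
    {s : ℝ} (hs : 0 < s) {v : (Fin n → ℂ) → ℂ} {B : ℝ}
    (hv : DifferentiableOn ℂ v (HStrip n s)) (hB : ∀ θ ∈ HStrip n s, ‖v θ‖ ≤ B)
    (hper : ∀ θ ∈ HStrip n s, ∀ j, v (θ + Pi.single j (2 * Real.pi : ℂ)) = v θ)
    (hmean : ∫ x in HBox n 0, v (HPt x 0) = 0) {σ : ℝ} (hσ : 0 < σ) (hσs : σ < s) :
    ∃ u : (Fin n → ℂ) → ℂ,
      DifferentiableOn ℂ u (HStrip n (s - σ)) ∧
      (∀ θ j, u (θ + Pi.single j (2 * Real.pi : ℂ)) = u θ) ∧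
      (∀ θ ∈ HStrip n (s - σ), fderiv ℂ u θ (fun j => (ω j : ℂ)) = v θ) ∧
      (∀ θ ∈ HStrip n (s - σ), ‖u θ‖ ≤
        B / α * ∑' k : Fin n → ℤ, HAbs k ^ τ * Real.exp (-σ * HAbs k)) := by
  have hB0 : 0 ≤ B := (norm_nonneg _).trans (hB 0 (zero_mem_HStrip hs))
  set W : Fin n → ℂ := fun j => (ω j : ℂ) with hW
  set d : (Fin n → ℤ) → ℂ := fun k => HCoef v k / (Complex.I * HPair k W) with hd
  have hc0 : HCoef v 0 = 0 := by rw [coef_zero, hmean]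
  have hdc : ∀ k, d k * Complex.I * HPair k W = HCoef v k := by
    intro k
    by_cases hk : k = 0
    · simp [hd, hk, hc0]
    · have h1 := hω k hk
      have h2 : 0 < α / HAbs k ^ τ := by
        have := HAbs_one_le hk
        positivity
      have h3 : HPair k W ≠ 0 := by
        rw [hW, HPair_real]
        exact_mod_cast abs_pos.1 (h2.trans_le h1)
      have := Complex.I_ne_zero
      simp only [hd]
      field_simp
  have hdb : ∀ k, ‖d k‖ ≤ B / α * (HAbs k ^ τ * Real.exp (-s * HAbs k)) := by
    intro k
    by_cases hk : k = 0
    · simp [hd, hk, hc0, HAbs_zero, Real.zero_rpow hτ.ne']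
    · have h1 := hω k hk
      have h0 := HAbs_one_le hk
      have h2 : 0 < α / HAbs k ^ τ := by
        positivity
      have h3 : ‖HPair k W‖ = |∑ j, (k j : ℝ) * ω j| := by
        rw [hW, HPair_real, Complex.norm_real, Real.norm_eq_abs]
      simp only [hd]
      rw [norm_div, norm_mul, Complex.norm_I, one_mul, h3]
      calc _ ≤ (B * Real.exp (-s * HAbs k)) / (α / HAbs k ^ τ) :=
            div_le_div₀ (by positivity) (HCoef_bound hs hv hB hper k) h2 h1
        _ = _ := by field_simp
  have hterm : ∀ k, ∀ θ ∈ HStrip n (s - σ), ‖d k * HChar k θ‖ ≤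
      B / α * (HAbs k ^ τ * Real.exp (-σ * HAbs k)) := by
    intro k θ hθ
    rw [norm_mul]
    have h0 := HAbs_nonneg k
    calc _ ≤ (B / α * (HAbs k ^ τ * Real.exp (-s * HAbs k))) * Real.exp ((s - σ) * HAbs k) :=
          mul_le_mul (hdb k) (HChar_norm_le k θ fun j => (hθ j).le) (norm_nonneg _)
            (by positivity)
      _ = B / α * (HAbs k ^ τ * (Real.exp (-s * HAbs k) * Real.exp ((s - σ) * HAbs k))) := by ring
      _ = _ := by rw [← Real.exp_add]; congr 3; ring
  have hsum1 := (poly_summable (n := n) τ hτ.le σ hσ).mul_left (B / α)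
  have hsum2 := (poly_summable (n := n) (τ + 1) (by positivity) σ hσ).mul_left (B / α)
  set L : (Fin n → ℤ) → (Fin n → ℂ) → ((Fin n → ℂ) →L[ℂ] ℂ) :=
    fun k θ => d k • ((HChar k θ * Complex.I) • HPairL k) with hL
  have hLd : ∀ k θ, HasFDerivAt (fun θ => d k * HChar k θ) (L k θ) θ := fun k θ =>
    (HChar_deriv k θ).const_mul (d k)
  have hLb : ∀ k, ∀ θ ∈ HStrip n (s - σ), ‖L k θ‖ ≤
      B / α * (HAbs k ^ (τ + 1) * Real.exp (-σ * HAbs k)) := by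
    intro k θ hθ
    simp only [hL]
    rw [norm_smul, norm_smul, norm_mul, Complex.norm_I, mul_one, ← mul_assoc, ← norm_mul]
    have h0 := HAbs_nonneg k
    refine (mul_le_mul (hterm k θ hθ) (HPairL_norm k) (norm_nonneg _) (by positivity)).trans ?_
    by_cases hk : k = 0
    · rw [hk, HAbs_zero, Real.zero_rpow (by positivity), Real.zero_rpow (by positivity)]; simp
    · rw [Real.rpow_add_one (by have := HAbs_one_le hk; positivity)]
      apply le_of_eq; ring
  have hz := zero_mem_HStrip (n := n) (sub_pos.2 hσs)
  have hfd : ∀ θ ∈ HStrip n (s - σ),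
      HasFDerivAt (fun θ => ∑' k, d k * HChar k θ) (∑' k, L k θ) θ := by
    intro θ hθ
    exact hasFDerivAt_tsum_of_isPreconnected hsum2 (HStrip_open n _)
      (HStrip_convex n _).isPreconnected (fun k θ _ => hLd k θ) hLb hz
      (Summable.of_norm_bounded hsum1 fun k => hterm k 0 hz) hθ
  refine ⟨fun θ => ∑' k, d k * HChar k θ, ?_, ?_, ?_, ?_⟩
  · exact fun θ hθ => (hfd θ hθ).differentiableAt.differentiableWithinAt
  · intro θ j
    simp only [HChar_per]
  · intro θ hθ
    rw [(hfd θ hθ).fderiv]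
    have hLs : Summable fun k => L k θ := Summable.of_norm_bounded hsum2 fun k => hLb k θ hθ
    have h1 : HasSum (fun k => L k θ W) ((∑' k, L k θ) W) :=
      apply_hasSum hLs.hasSum W
    have h2 : HasSum (fun k => L k θ W) (v θ) := by
      convert HFourier hs hv hB hper θ (fun j => (hθ j).trans (by linarith)) using 2 with k
      simp only [hL, ContinuousLinearMap.smul_apply, HPairL_apply, smul_eq_mul]
      rw [← hdc k]; ring
    exact h1.unique h2
  · intro θ hθ
    rw [← tsum_mul_left]
    exact tsum_of_norm_bounded hsum1.hasSum fun k => hterm k θ hθ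

/-- Lemma 1: solution of the homological equation `∂_ω u = v` with small divisors.
For `ω` an `(α,τ)`-diophantine frequency and `v` bounded holomorphic on the strip
`S_s`, `2π`-periodic with zero mean, there is for every `0 < σ < s` a bounded
holomorphic `2π`-periodic zero-mean solution `u` on `S_(s-σ)` with
`sup|u| ≤ c/(α σ^(τ+n)) · sup|v|`, `c` depending only on `n` and `τ`; moreover the
zero-mean solution is unique. -/
theorem homological_equation (n : ℕ) (hn : 1 ≤ n) (τ : ℝ) (hτ : 0 < τ) :
    ∃ c : ℝ, 0 < c ∧
    ∀ (α : ℝ), 0 < α → ∀ ω : Fin n → ℝ,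
      (∀ k : Fin n → ℤ, k ≠ 0 →
        α / ((∑ j, |k j| : ℤ) : ℝ) ^ τ ≤ |∑ j, (k j : ℝ) * ω j|) →
    ∀ (s : ℝ), 0 < s → ∀ (v : (Fin n → ℂ) → ℂ) (B : ℝ),
      DifferentiableOn ℂ v {θ : Fin n → ℂ | ∀ j, |(θ j).im| < s} →
      (∀ θ ∈ {θ : Fin n → ℂ | ∀ j, |(θ j).im| < s}, ‖v θ‖ ≤ B) →
      (∀ θ ∈ {θ : Fin n → ℂ | ∀ j, |(θ j).im| < s}, ∀ j,
        v (θ + Pi.single j (2 * Real.pi : ℂ)) = v θ) →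
      (∫ x in Set.univ.pi fun _ : Fin n => Set.Icc (0 : ℝ) (2 * Real.pi),
        v (fun j => (x j : ℂ))) = 0 →
      -- existence with the estimate, for every 0 < σ < s
      (∀ σ : ℝ, 0 < σ → σ < s →
        ∃ u : (Fin n → ℂ) → ℂ,
          DifferentiableOn ℂ u {θ : Fin n → ℂ | ∀ j, |(θ j).im| < s - σ} ∧
          (∀ θ ∈ {θ : Fin n → ℂ | ∀ j, |(θ j).im| < s - σ}, ∀ j,
            u (θ + Pi.single j (2 * Real.pi : ℂ)) = u θ) ∧
          (∫ x in Set.univ.pi fun _ : Fin n => Set.Icc (0 : ℝ) (2 * Real.pi),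
            u (fun j => (x j : ℂ))) = 0 ∧
          (∀ θ ∈ {θ : Fin n → ℂ | ∀ j, |(θ j).im| < s - σ},
            ∑ j, (ω j : ℂ) * fderiv ℂ u θ (Pi.single j 1) = v θ) ∧
          (∀ θ ∈ {θ : Fin n → ℂ | ∀ j, |(θ j).im| < s - σ},
            ‖u θ‖ ≤ c / (α * σ ^ (τ + (n : ℝ))) * B)) ∧
      -- uniqueness of the zero-mean solution on common domains
      (∀ σ₁ σ₂ : ℝ, 0 < σ₁ → σ₁ < s → 0 < σ₂ → σ₂ < s →
        ∀ u₁ u₂ : (Fin n → ℂ) → ℂ,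
          DifferentiableOn ℂ u₁ {θ : Fin n → ℂ | ∀ j, |(θ j).im| < s - σ₁} →
          DifferentiableOn ℂ u₂ {θ : Fin n → ℂ | ∀ j, |(θ j).im| < s - σ₂} →
          (∃ B₁ : ℝ, ∀ θ ∈ {θ : Fin n → ℂ | ∀ j, |(θ j).im| < s - σ₁}, ‖u₁ θ‖ ≤ B₁) →
          (∃ B₂ : ℝ, ∀ θ ∈ {θ : Fin n → ℂ | ∀ j, |(θ j).im| < s - σ₂}, ‖u₂ θ‖ ≤ B₂) →
          (∀ θ ∈ {θ : Fin n → ℂ | ∀ j, |(θ j).im| < s - σ₁}, ∀ j,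
            u₁ (θ + Pi.single j (2 * Real.pi : ℂ)) = u₁ θ) →
          (∀ θ ∈ {θ : Fin n → ℂ | ∀ j, |(θ j).im| < s - σ₂}, ∀ j,
            u₂ (θ + Pi.single j (2 * Real.pi : ℂ)) = u₂ θ) →
          (∫ x in Set.univ.pi fun _ : Fin n => Set.Icc (0 : ℝ) (2 * Real.pi),
            u₁ (fun j => (x j : ℂ))) = 0 →
          (∫ x in Set.univ.pi fun _ : Fin n => Set.Icc (0 : ℝ) (2 * Real.pi),
            u₂ (fun j => (x j : ℂ))) = 0 →
          (∀ θ ∈ {θ : Fin n → ℂ | ∀ j, |(θ j).im| < s - σ₁},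
            ∑ j, (ω j : ℂ) * fderiv ℂ u₁ θ (Pi.single j 1) = v θ) →
          (∀ θ ∈ {θ : Fin n → ℂ | ∀ j, |(θ j).im| < s - σ₂},
            ∑ j, (ω j : ℂ) * fderiv ℂ u₂ θ (Pi.single j 1) = v θ) →
          ∀ θ ∈ {θ : Fin n → ℂ | ∀ j, |(θ j).im| < s - max σ₁ σ₂},
            u₁ θ = u₂ θ) := by
  classical
  obtain ⟨c₀, hc₀, hc⟩ := poly_tsum_bound n τ hτ
  refine ⟨2 * c₀, by positivity, ?_⟩
  intro α hα ω hω s hs v B hv hB hper hmean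
  have hω' : ∀ k : Fin n → ℤ, k ≠ 0 → α / HAbs k ^ τ ≤ |∑ j, (k j : ℝ) * ω j| := by
    intro k hk
    have := hω k hk
    push_cast at this
    exact this
  have hB0 : 0 ≤ B := (norm_nonneg _).trans (hB 0 (zero_mem_HStrip hs))
  have hmean' := coef_zero_of_mean v hmean
  refine ⟨?_, ?_⟩
  · intro σ hσ hσs
    obtain ⟨u, hu, huper, hueq, hub⟩ := exist_aux hτ hα ω hω' hs hv hB hper hmean' hσ hσs
    have hz := zero_mem_HStrip (n := n) (sub_pos.2 hσs)
    set K := B / α * ∑' k : Fin n → ℤ, HAbs k ^ τ * Real.exp (-σ * HAbs k) with hK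
    have hint : Integrable (fun x => u (HPt x 0))
        ((volume : Measure (Fin n → ℝ)).restrict (HBox n 0)) :=
      Integrable.of_bound (comp_cont hu hz).aestronglyMeasurable K
        (Filter.Eventually.of_forall fun x => hub _ (HPt_mem x hz))
    set m := ∫ x in HBox n 0, u (HPt x 0) with hm
    have hmb : ‖m‖ ≤ K := by
      have := norm_setIntegral_le_of_norm_le_const (μ := volume) (s := HBox n 0)
        (f := fun x => u (HPt x 0)) (C := K) (by simp [HBox_vol])
        (fun x _ => hub _ (HPt_mem x hz))
      simpa [Measure.real, HBox_vol] using this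
    refine ⟨fun θ => u θ - m, hu.sub_const m, ?_, ?_, ?_, ?_⟩
    · intro θ _ j
      simp only [huper]
    · rw [mean_eq (fun θ => u θ - m), integral_sub hint (integrable_const _), ← hm]
      simp
    · intro θ hθ
      rw [sum_fderiv, fderiv_sub_const]
      exact hueq θ hθ
    · intro θ hθ
      have h1 : K ≤ B / α * (c₀ / σ ^ (τ + (n : ℝ))) := by
        rw [hK]
        exact mul_le_mul_of_nonneg_left (hc σ hσ) (by positivity)
      have h2 := norm_sub_le (u θ) m
      have h3 := hub θ hθ
      have h4 : 2 * c₀ / (α * σ ^ (τ + (n : ℝ))) * B = 2 * (B / α * (c₀ / σ ^ (τ + (n : ℝ)))) := by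
        field_simp
      rw [h4]
      linarith
  · intro σ₁ σ₂ hσ₁ hσ₁s hσ₂ hσ₂s u₁ u₂ hu₁ hu₂ hb₁ hb₂ hp₁ hp₂ hm₁ hm₂ he₁ he₂ θ hθ
    obtain ⟨B₁, hB₁⟩ := hb₁
    obtain ⟨B₂, hB₂⟩ := hb₂
    have hs' : 0 < s - max σ₁ σ₂ := sub_pos.2 (max_lt hσ₁s hσ₂s)
    have hsub₁ : HStrip n (s - max σ₁ σ₂) ⊆ HStrip n (s - σ₁) := fun η hη j =>
      (hη j).trans_le (by have := le_max_left σ₁ σ₂; linarith)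
    have hsub₂ : HStrip n (s - max σ₁ σ₂) ⊆ HStrip n (s - σ₂) := fun η hη j =>
      (hη j).trans_le (by have := le_max_right σ₁ σ₂; linarith)
    have hz₁ := zero_mem_HStrip (n := n) (sub_pos.2 hσ₁s)
    have hz₂ := zero_mem_HStrip (n := n) (sub_pos.2 hσ₂s)
    have hi₁ : Integrable (fun x => u₁ (HPt x 0))
        ((volume : Measure (Fin n → ℝ)).restrict (HBox n 0)) :=
      Integrable.of_bound (comp_cont hu₁ hz₁).aestronglyMeasurable B₁
        (Filter.Eventually.of_forall fun x => hB₁ _ (HPt_mem x hz₁))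
    have hi₂ : Integrable (fun x => u₂ (HPt x 0))
        ((volume : Measure (Fin n → ℝ)).restrict (HBox n 0)) :=
      Integrable.of_bound (comp_cont hu₂ hz₂).aestronglyMeasurable B₂
        (Filter.Eventually.of_forall fun x => hB₂ _ (HPt_mem x hz₂))
    have hfin := uniq_aux (w := fun η => u₁ η - u₂ η) (C := B₁ + B₂) hs'
      ((hu₁.mono hsub₁).sub (hu₂.mono hsub₂))
      (fun η hη => (norm_sub_le _ _).trans (add_le_add (hB₁ η (hsub₁ hη)) (hB₂ η (hsub₂ hη))))
      (fun η hη j => by simp only [hp₁ η (hsub₁ hη), hp₂ η (hsub₂ hη)])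
      ω
      (fun k hk => by
        have h1 := hω' k hk
        have h0 := HAbs_one_le hk
        have h2 : 0 < α / HAbs k ^ τ := by positivity
        exact abs_pos.1 (h2.trans_le h1))
      (by rw [integral_sub hi₁ hi₂, coef_zero_of_mean u₁ hm₁, coef_zero_of_mean u₂ hm₂, sub_zero])
      (fun η hη => by
        have d₁ := hu₁.differentiableAt ((HStrip_open n _).mem_nhds (hsub₁ hη))
        have d₂ := hu₂.differentiableAt ((HStrip_open n _).mem_nhds (hsub₂ hη))
        have e₁ := he₁ η (hsub₁ hη)
        have e₂ := he₂ η (hsub₂ hη)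
        rw [sum_fderiv] at e₁ e₂
        rw [fderiv_fun_sub d₁ d₂, _root_.sub_apply, e₁, e₂, sub_self])
      θ hθ
    exact sub_eq_zero.1 hfin
end

section
/- (Lemma A.3, quantitative analytic inverse function theorem.) Let Ω ⊂ ℝⁿ be a nonempty set, h > 0, and for ρ > 0 let O_ρ = {z ∈ ℂⁿ : dist_∞(z, Ω) < ρ}. Let f : O_h → ℂⁿ be holomorphic, mapping O_h ∩ ℝⁿ into ℝⁿ, and suppose sup_{O_h} |f(z) − z|_∞ ≤ δ where δ ≤ h/4. Then f has a holomorphic inverse φ on O_{h/4}: there is a holomorphic map φ : O_{h/4} → O_{h/2}, real on O_{h/4} ∩ ℝⁿ, with f(φ(w)) = w for all w ∈ O_{h/4}, and moreover sup_{O_{h/4}} |φ(w) − w|_∞ ≤ δ and sup_{O_{h/4}} ‖Dφ(w) − Id‖ ≤ 4δ/h, where ‖·‖ is the operator norm induced by the sup-norm. -/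
open Metric Set Filter Topology

/-- Cauchy estimate for the Frechet derivative. -/
lemma aif_cauchy {E : Type*} [NormedAddCommGroup E] [NormedSpace ℂ E]
    (u : E → E) (z : E) (R δ : ℝ) (hR : 0 < R) (hδ0 : 0 ≤ δ)
    (hu : DifferentiableOn ℂ u (ball z R)) (hb : ∀ y ∈ ball z R, ‖u y‖ ≤ δ) :
    ‖fderiv ℂ u z‖ ≤ δ / R := by
  refine ContinuousLinearMap.opNorm_le_bound _ (by positivity) fun v => ?_
  by_cases hv : v = 0
  · simp [hv]
  have hv' : 0 < ‖v‖ := norm_pos_iff.2 hv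
  have key : ∀ r, 0 < r → r < R → r * ‖fderiv ℂ u z v‖ ≤ δ * ‖v‖ := by
    intro r hr hrR
    have hmem : ∀ t ∈ closedBall (0 : ℂ) (r / ‖v‖), z + t • v ∈ ball z R := by
      intro t ht
      have ht' : ‖t‖ ≤ r / ‖v‖ := by simpa using ht
      rw [mem_ball, dist_eq_norm, add_sub_cancel_left, norm_smul]
      rw [le_div_iff₀ hv'] at ht'
      linarith
    have hlin : ∀ t : ℂ, HasDerivAt (fun t : ℂ => z + t • v) v t := by
      intro t
      simpa using ((hasDerivAt_id t).smul_const v).const_add z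
    have hg : ∀ t ∈ closedBall (0 : ℂ) (r / ‖v‖),
        DifferentiableAt ℂ (fun t : ℂ => u (z + t • v)) t := by
      intro t ht
      have h1 := hu.differentiableAt (isOpen_ball.mem_nhds (hmem t ht))
      exact DifferentiableAt.comp (g := u) t h1 (hlin t).differentiableAt
    have hrv : 0 < r / ‖v‖ := by positivity
    have hd : DiffContOnCl ℂ (fun t : ℂ => u (z + t • v)) (ball 0 (r / ‖v‖)) := by
      apply DifferentiableOn.diffContOnCl
      intro t ht
      exact (hg t (closure_ball_subset_closedBall ht)).differentiableWithinAt
    have h2 := Complex.norm_deriv_le_of_forall_mem_sphere_norm_le hrv hd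
      (C := δ) (fun t ht => hb _ (hmem t (sphere_subset_closedBall ht)))
    have h3 : deriv (fun t : ℂ => u (z + t • v)) 0 = fderiv ℂ u z v := by
      have h1 : HasFDerivAt u (fderiv ℂ u z) (z + (0 : ℂ) • v) := by
        simpa using (hu.differentiableAt (ball_mem_nhds z hR)).hasFDerivAt
      exact (h1.comp_hasDerivAt (0 : ℂ) (hlin 0)).deriv
    rw [h3, div_div_eq_mul_div, le_div_iff₀ hr] at h2
    linarith
  rw [div_mul_eq_mul_div, le_div_iff₀ hR]
  by_contra hcon
  push Not at hcon
  have ha : 0 < ‖fderiv ℂ u z v‖ := by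
    rcases (norm_nonneg (fderiv ℂ u z v)).eq_or_lt with h0 | h0
    · rw [← h0] at hcon
      nlinarith
    · exact h0
  have hlt : δ * ‖v‖ / ‖fderiv ℂ u z v‖ < R := by
    rw [div_lt_iff₀ ha]
    linarith
  obtain ⟨r, hr1, hr2⟩ := exists_between hlt
  have hr0 : 0 < r := lt_of_le_of_lt (by positivity) hr1
  have := key r hr0 hr2
  rw [div_lt_iff₀ ha] at hr1
  linarith



/-- Lemma A.3: quantitative analytic inverse function theorem. If `f` is
holomorphic on `O_h` (the complex sup-norm `h`-neighbourhood of `Ω ⊆ ℝⁿ`), real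
on real points, and `sup_{O_h}|f - id|_∞ ≤ δ ≤ h/4`, then `f` has a holomorphic
inverse `φ : O_(h/4) → O_(h/2)` with `|φ - id|_∞ ≤ δ` and `‖Dφ - Id‖ ≤ 4δ/h`. -/
theorem analytic_inverse_function (n : ℕ) (Ω : Set (Fin n → ℝ)) (hΩ : Ω.Nonempty)
    (h δ : ℝ) (hh : 0 < h) (f : (Fin n → ℂ) → (Fin n → ℂ))
    (hf : DifferentiableOn ℂ f {z : Fin n → ℂ | ∃ x ∈ Ω, ‖z - (fun j => (x j : ℂ))‖ < h})
    (hreal : ∀ z ∈ {z : Fin n → ℂ | ∃ x ∈ Ω, ‖z - (fun j => (x j : ℂ))‖ < h},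
      (∀ j, (z j).im = 0) → ∀ j, (f z j).im = 0)
    (hδ : ∀ z ∈ {z : Fin n → ℂ | ∃ x ∈ Ω, ‖z - (fun j => (x j : ℂ))‖ < h},
      ‖f z - z‖ ≤ δ)
    (hδh : δ ≤ h / 4) :
    ∃ φ : (Fin n → ℂ) → (Fin n → ℂ),
      DifferentiableOn ℂ φ {z : Fin n → ℂ | ∃ x ∈ Ω, ‖z - (fun j => (x j : ℂ))‖ < h / 4} ∧
      (∀ w ∈ {z : Fin n → ℂ | ∃ x ∈ Ω, ‖z - (fun j => (x j : ℂ))‖ < h / 4},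
        φ w ∈ {z : Fin n → ℂ | ∃ x ∈ Ω, ‖z - (fun j => (x j : ℂ))‖ < h / 2} ∧
        f (φ w) = w ∧ ‖φ w - w‖ ≤ δ) ∧
      (∀ w ∈ {z : Fin n → ℂ | ∃ x ∈ Ω, ‖z - (fun j => (x j : ℂ))‖ < h / 4},
        (∀ j, (w j).im = 0) → ∀ j, (φ w j).im = 0) ∧
      (∀ w ∈ {z : Fin n → ℂ | ∃ x ∈ Ω, ‖z - (fun j => (x j : ℂ))‖ < h / 4},
        ‖fderiv ℂ φ w - ContinuousLinearMap.id ℂ (Fin n → ℂ)‖ ≤ 4 * δ / h) := by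
  classical
  set O : ℝ → Set (Fin n → ℂ) := fun ρ => {z | ∃ x ∈ Ω, ‖z - (fun j => (x j : ℂ))‖ < ρ} with hO
  change DifferentiableOn ℂ f (O h) at hf
  change ∀ z ∈ O h, _ at hreal
  change ∀ z ∈ O h, _ at hδ
  change ∃ φ : (Fin n → ℂ) → (Fin n → ℂ), DifferentiableOn ℂ φ (O (h / 4)) ∧
    (∀ w ∈ O (h / 4), φ w ∈ O (h / 2) ∧ f (φ w) = w ∧ ‖φ w - w‖ ≤ δ) ∧
    (∀ w ∈ O (h / 4), (∀ j, (w j).im = 0) → ∀ j, (φ w j).im = 0) ∧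
    (∀ w ∈ O (h / 4), ‖fderiv ℂ φ w - ContinuousLinearMap.id ℂ (Fin n → ℂ)‖ ≤ 4 * δ / h)
  have hδ0 : 0 ≤ δ := by
    obtain ⟨x, hx⟩ := hΩ
    exact (norm_nonneg _).trans (hδ (fun j => (x j : ℂ)) ⟨x, hx, by simpa using hh⟩)
  have hball : ∀ x ∈ Ω, ∀ ρ, ball (fun j => (x j : ℂ)) ρ ⊆ O ρ := by
    intro x hx ρ z hz
    exact ⟨x, hx, by simpa [dist_eq_norm] using hz⟩
  set u : (Fin n → ℂ) → (Fin n → ℂ) := fun z => f z - z with hu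
  have hc : δ / (h / 2) ≤ 1 / 2 := by
    rw [div_le_iff₀ (by positivity)]; linarith
  have hc0 : 0 ≤ δ / (h / 2) := by positivity
  have hud : ∀ x ∈ Ω, DifferentiableOn ℂ u (ball (fun j => (x j : ℂ)) h) := by
    intro x hx
    exact (hf.mono (hball x hx h)).sub differentiableOn_id
  have hsub : ∀ x : Fin n → ℝ, ∀ z ∈ ball (fun j => (x j : ℂ)) (h / 2),
      ball z (h / 2) ⊆ ball (fun j => (x j : ℂ)) h := by
    intro x z hz
    apply ball_subset_ball'
    rw [mem_ball] at hz
    linarith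
  have hudA : ∀ x ∈ Ω, ∀ z ∈ ball (fun j => (x j : ℂ)) (h / 2), DifferentiableAt ℂ u z := by
    intro x hx z hz
    exact (hud x hx).differentiableAt
      (isOpen_ball.mem_nhds (hsub x z hz (mem_ball_self (by positivity))))
  have hfd : ∀ x ∈ Ω, ∀ z ∈ ball (fun j => (x j : ℂ)) (h / 2),
      ‖fderiv ℂ u z‖ ≤ δ / (h / 2) := by
    intro x hx z hz
    exact aif_cauchy u z (h / 2) δ (by positivity) hδ0 ((hud x hx).mono (hsub x z hz))
      (fun y hy => hδ y (hball x hx h (hsub x z hz hy)))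
  have hlip : ∀ x ∈ Ω, ∀ y ∈ ball (fun j => (x j : ℂ)) (h / 2),
      ∀ z ∈ ball (fun j => (x j : ℂ)) (h / 2), ‖u y - u z‖ ≤ 1 / 2 * ‖y - z‖ := by
    intro x hx y hy z hz
    refine ((convex_ball _ _).norm_image_sub_le_of_norm_fderiv_le (𝕜 := ℂ) (hudA x hx)
      (hfd x hx) hz hy).trans ?_
    gcongr
  have hin : ∀ x : Fin n → ℝ, ∀ w ∈ ball (fun j => (x j : ℂ)) (h / 4), ∀ z, ‖z - w‖ ≤ δ →
      z ∈ ball (fun j => (x j : ℂ)) (h / 2) := by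
    intro x w hw z hz
    rw [mem_ball] at hw ⊢
    have := dist_triangle z w (fun j => (x j : ℂ))
    rw [dist_eq_norm z w] at this
    linarith
  have hOb : ∀ w ρ, w ∈ O ρ → ∃ x ∈ Ω, w ∈ ball (fun j => (x j : ℂ)) ρ := by
    rintro w ρ ⟨x, hx, hw⟩
    exact ⟨x, hx, by simpa [dist_eq_norm] using hw⟩
  have hex : ∀ w ∈ O (h / 4), ∃ z, f z = w ∧ ‖z - w‖ ≤ δ ∧
      ((∀ j, (w j).im = 0) → ∀ j, (z j).im = 0) := by
    intro w hw
    obtain ⟨x, hx, hwx⟩ := hOb w _ hw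
    let S : Set (Fin n → ℂ) :=
      closedBall w δ ∩ {z | (∀ j, (w j).im = 0) → ∀ j, (z j).im = 0}
    have hScl : IsClosed S := by
      refine isClosed_closedBall.inter ?_
      simp only [setOf_forall]
      refine isClosed_iInter fun _ => isClosed_iInter fun j => ?_
      exact isClosed_eq (by fun_prop) continuous_const
    have hSb : ∀ z ∈ S, z ∈ ball (fun j => (x j : ℂ)) (h / 2) := by
      intro z hz
      exact hin x w hwx z (by simpa [dist_eq_norm] using hz.1)
    have hSO : ∀ z ∈ S, z ∈ O h := by
      intro z hz
      exact hball x hx h (ball_subset_ball (by linarith) (hSb z hz))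
    have hmaps : MapsTo (fun z => w - u z) S S := by
      intro z hz
      refine ⟨?_, ?_⟩
      · rw [mem_closedBall, dist_eq_norm]
        simpa using hδ z (hSO z hz)
      · intro hwr j
        have h1 := hz.2 hwr
        have h2 := hreal z (hSO z hz) h1 j
        simp [hu, hwr j, h1 j, h2]
    have hcon : ContractingWith (1 / 2) (hmaps.restrict (fun z => w - u z) S S) := by
      refine ⟨by rw [← NNReal.coe_lt_coe]; norm_num, LipschitzWith.of_dist_le_mul ?_⟩
      rintro ⟨y, hy⟩ ⟨z, hz⟩
      rw [Subtype.dist_eq, Subtype.dist_eq, dist_eq_norm, dist_eq_norm]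
      have := hlip x hx z (hSb z hz) y (hSb y hy)
      simpa [norm_sub_rev z y] using this
    obtain ⟨z, hzS, hzf, -⟩ := hcon.exists_fixedPoint' hScl.isComplete hmaps (x := w)
      ⟨mem_closedBall_self hδ0, fun hr => hr⟩ (edist_ne_top _ _)
    refine ⟨z, ?_, by simpa [dist_eq_norm] using hzS.1, hzS.2⟩
    have h5 : w - (f z - z) = z := hzf
    have h6 : f z = w + z - (w - (f z - z)) := by abel
    rw [h6, h5]; abel
  choose! φ hφ1 hφ2 hφ3 using hex
  have hφin : ∀ x ∈ Ω, ∀ w ∈ ball (fun j => (x j : ℂ)) (h / 4),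
      φ w ∈ ball (fun j => (x j : ℂ)) (h / 2) := by
    intro x hx w hw
    exact hin x w hw _ (hφ2 w (hball x hx _ hw))
  have hφlip : ∀ x ∈ Ω, LipschitzOnWith 2 φ (ball (fun j => (x j : ℂ)) (h / 4)) := by
    intro x hx
    refine LipschitzOnWith.of_dist_le_mul fun a ha b hb => ?_
    rw [dist_eq_norm, dist_eq_norm]
    have h1 := hlip x hx _ (hφin x hx a ha) _ (hφin x hx b hb)
    have h2 : φ a - φ b = (a - b) - (u (φ a) - u (φ b)) := by
      simp only [hu, hφ1 a (hball x hx _ ha), hφ1 b (hball x hx _ hb)]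
      abel
    have h3 := norm_sub_le (a - b) (u (φ a) - u (φ b))
    rw [← h2] at h3
    norm_num
    linarith
  have hder : ∀ w ∈ O (h / 4), ∃ L : (Fin n → ℂ) →L[ℂ] (Fin n → ℂ), HasFDerivAt φ L w ∧
      ‖L - ContinuousLinearMap.id ℂ (Fin n → ℂ)‖ ≤ 4 * δ / h := by
    intro w hw
    obtain ⟨x, hx, hwx⟩ := hOb w _ hw
    have hz := hφin x hx w hwx
    set A := fderiv ℂ u (φ w) with hA
    have hAn : ‖A‖ ≤ δ / (h / 2) := hfd x hx _ hz
    have hlt : ‖-A‖ < 1 := by rw [norm_neg]; linarith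
    let e : (Fin n → ℂ) ≃L[ℂ] (Fin n → ℂ) :=
      ContinuousLinearEquiv.ofUnit (Units.oneSub (-A) hlt)
    have he : (e : (Fin n → ℂ) →L[ℂ] (Fin n → ℂ)) = A + ContinuousLinearMap.id ℂ _ := by
      ext1 v
      change ((Units.oneSub (-A) hlt : ((Fin n → ℂ) →L[ℂ] (Fin n → ℂ))ˣ) :
        (Fin n → ℂ) →L[ℂ] (Fin n → ℂ)) v = _
      simp [add_comm]
    have hfder : HasFDerivAt f (e : (Fin n → ℂ) →L[ℂ] (Fin n → ℂ)) (φ w) := by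
      rw [he]
      have := (hudA x hx _ hz).hasFDerivAt.add (hasFDerivAt_id (φ w))
      refine this.congr_of_eventuallyEq (Eventually.of_forall fun y => ?_)
      simp [hu]
    have hnhds := isOpen_ball.mem_nhds hwx
    have hL := HasFDerivAt.of_local_left_inverse
      ((hφlip x hx).continuousOn.continuousAt hnhds) hfder
      (by filter_upwards [hnhds] with y hy using hφ1 y (hball x hx _ hy))
    refine ⟨_, hL, ContinuousLinearMap.opNorm_le_bound _ (by positivity) fun v => ?_⟩
    have h1 : A (e.symm v) + e.symm v = v := by
      have := e.apply_symm_apply v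
      rw [← ContinuousLinearEquiv.coe_coe, he] at this
      simpa using this
    have h2 : ‖A (e.symm v)‖ ≤ δ / (h / 2) * ‖e.symm v‖ := A.le_of_opNorm_le hAn _
    have h3 : ‖e.symm v‖ ≤ 2 * ‖v‖ := by
      have h4 : e.symm v = v - A (e.symm v) := eq_sub_of_add_eq' h1
      have h5 := norm_sub_le v (A (e.symm v))
      rw [← h4] at h5
      nlinarith [norm_nonneg (e.symm v)]
    have h6 : e.symm v - v = -A (e.symm v) := by
      nth_rewrite 2 [← h1]; abel
    calc _ = ‖A (e.symm v)‖ := by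
            rw [← norm_neg (A _), ← h6]; simp
      _ ≤ δ / (h / 2) * (2 * ‖v‖) := h2.trans (by gcongr)
      _ = _ := by field_simp; ring
  refine ⟨φ, ?_, ?_, hφ3, ?_⟩
  · intro w hw
    obtain ⟨L, hL, -⟩ := hder w hw
    exact hL.differentiableAt.differentiableWithinAt
  · intro w hw
    obtain ⟨x, hx, hwx⟩ := hOb w _ hw
    exact ⟨hball x hx _ (hφin x hx w hwx), hφ1 w hw, hφ2 w hw⟩
  · intro w hw
    obtain ⟨L, hL, hn⟩ := hder w hw
    rw [hL.fderiv]
    exact hn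
end

section
/- (Measure of the union of all resonance zones.) Let n ≥ 1, τ > n−1, M > 0, and let Ω ⊂ ℝⁿ be a measurable set contained in the ball {|ω| ≤ M}. Then there is a constant C depending only on n, τ and M such that for every α > 0 the Lebesgue measure of R_α^τ ∩ Ω satisfies m(R_α^τ ∩ Ω) ≤ C·α, where R_α^τ = ⋃_{0≠k∈ℤⁿ} {ω ∈ ℝⁿ : |⟨k,ω⟩| < α/|k|₁^τ} is the complement of the set Δ_α^τ of (α,τ)-diophantine frequencies. -/
open MeasureTheory

/-- The lattice series `∑ ‖k‖ ^ r` converges for `r < -n`. -/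
lemma summable_intVec_norm_rpow (n : ℕ) (r : ℝ) (hr : r < -(n : ℝ)) :
    Summable fun k : Fin n → ℤ => ‖k‖ ^ r := by
  let L : Submodule ℤ (Fin n → ℝ) := Submodule.span ℤ (Set.range (Pi.basisFun ℝ (Fin n)))
  have hmem : ∀ k : Fin n → ℤ, (fun j => (k j : ℝ)) ∈ L := by
    intro k
    have : (fun j => (k j : ℝ)) = ∑ i, k i • (Pi.basisFun ℝ (Fin n) i) := by
      ext j
      simp [Finset.sum_apply, Pi.single_apply]
    rw [this]
    exact Submodule.sum_mem _ fun i _ =>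
      Submodule.smul_mem _ _ (Submodule.subset_span ⟨i, rfl⟩)
  have hrank : Module.finrank ℤ L = n := by
    rw [ZLattice.rank ℝ L]
    simp
  have hs := ZLattice.summable_norm_rpow L r (by rw [hrank]; exact hr)
  let f : (Fin n → ℤ) → L := fun k => ⟨fun j => (k j : ℝ), hmem k⟩
  have hf : Function.Injective f := by
    intro a b hab
    have h1 := congrArg Subtype.val hab
    ext j
    have h2 : (a j : ℝ) = (b j : ℝ) := congrFun h1 j
    exact_mod_cast h2
  refine (hs.comp_injective hf).congr fun k => ?_
  have : ‖f k‖ = ‖k‖ := by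
    change ‖fun j => (k j : ℝ)‖ = ‖k‖
    simp [Pi.norm_def, nnnorm]
    rfl
  simp [Function.comp, this]

/-- Measure of a single resonance slab inside a box. -/
lemma volume_slab_le (n : ℕ) (M δ : ℝ) (v : Fin n → ℝ) (i : Fin n) (hv : v i ≠ 0) :
    volume {ω : Fin n → ℝ | (∀ j, |ω j| ≤ M) ∧ |∑ j, v j * ω j| < δ}
      ≤ ENNReal.ofReal |(v i)⁻¹| *
        (ENNReal.ofReal (2 * δ) * ENNReal.ofReal (2 * M) ^ (n - 1)) := by
  let A : Matrix (Fin n) (Fin n) ℝ := (1 : Matrix (Fin n) (Fin n) ℝ).updateRow i v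
  have hdet : A.det = v i := by
    have := Matrix.cramer_transpose_apply (1 : Matrix (Fin n) (Fin n) ℝ) v i
    rw [← this]
    simp
  have hdet' : LinearMap.det (Matrix.toLin' A) = v i := by
    rw [LinearMap.det_toLin', hdet]
  let S : Fin n → Set ℝ := Function.update (fun _ => Set.Icc (-M) M) i (Set.Ioo (-δ) δ)
  have hsub : {ω : Fin n → ℝ | (∀ j, |ω j| ≤ M) ∧ |∑ j, v j * ω j| < δ}
      ⊆ Matrix.toLin' A ⁻¹' (Set.univ.pi S) := by
    rintro ω ⟨h1, h2⟩ j -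
    by_cases hj : j = i
    · subst hj
      simpa [S, A, Matrix.toLin'_apply, Matrix.mulVec, dotProduct, abs_lt] using h2
    · have : (Matrix.toLin' A ω) j = ω j := by
        simp [A, Matrix.toLin'_apply, Matrix.mulVec, dotProduct, hj, Matrix.one_apply]
      rw [this]
      simpa [S, hj, abs_le] using h1 j
  refine (measure_mono hsub).trans ?_
  rw [Measure.addHaar_preimage_linearMap _ (by rw [hdet']; exact hv), hdet', volume_pi_pi]
  have : ∀ j, volume (S j) = Function.update (fun _ => ENNReal.ofReal (2 * M)) i
      (ENNReal.ofReal (2 * δ)) j := by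
    intro j
    by_cases hj : j = i
    · subst hj
      simp [S, two_mul]
    · simp [S, hj, two_mul]
  simp_rw [this]
  rw [Finset.prod_update_of_mem (Finset.mem_univ i)]
  simp [Finset.card_sdiff]

/-- Measure of the union of all resonance zones: for `τ > n-1` and `Ω` contained
in the Euclidean ball of radius `M`, `m(R_α^τ ∩ Ω) ≤ C·α` with `C` depending only
on `n`, `τ` and `M`. -/
theorem measure_union_resonance_zones (n : ℕ) (hn : 1 ≤ n) (τ M : ℝ)
    (hτ : (n : ℝ) - 1 < τ) (hM : 0 < M) :
    ∃ C : ℝ, 0 < C ∧ ∀ α : ℝ, 0 < α →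
      ∀ Ω : Set (Fin n → ℝ), MeasurableSet Ω →
        (∀ ω ∈ Ω, Real.sqrt (∑ j, ω j ^ 2) ≤ M) →
        volume {ω ∈ Ω | ∃ k : Fin n → ℤ, k ≠ 0 ∧
            |∑ j, (k j : ℝ) * ω j| < α / ((∑ j, |k j| : ℤ) : ℝ) ^ τ}
          ≤ ENNReal.ofReal (C * α) := by
  have hn1 : (1 : ℝ) ≤ n := by exact_mod_cast hn
  have hτ0 : 0 < τ := by linarith
  have hsum := summable_intVec_norm_rpow n (-(τ + 1)) (by linarith)
  set T : ℝ := ∑' k : Fin n → ℤ, ‖k‖ ^ (-(τ + 1)) with hT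
  have hT0 : 0 ≤ T := tsum_nonneg fun k => by positivity
  set c : ℝ := 2 * (2 * M) ^ (n - 1) with hc
  have hc0 : 0 < c := by positivity
  refine ⟨c * (T + 1), by positivity, fun α hα Ω _ hΩ => ?_⟩
  let Z : (Fin n → ℤ) → Set (Fin n → ℝ) := fun k =>
    {ω | k ≠ 0 ∧ (∀ j, |ω j| ≤ M) ∧
      |∑ j, (k j : ℝ) * ω j| < α / ((∑ j, |k j| : ℤ) : ℝ) ^ τ}
  have hsub : {ω ∈ Ω | ∃ k : Fin n → ℤ, k ≠ 0 ∧
      |∑ j, (k j : ℝ) * ω j| < α / ((∑ j, |k j| : ℤ) : ℝ) ^ τ} ⊆ ⋃ k, Z k := by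
    rintro ω ⟨hω, k, hk, h⟩
    refine Set.mem_iUnion.2 ⟨k, hk, fun j => ?_, h⟩
    refine le_trans (Real.abs_le_sqrt ?_) (hΩ ω hω)
    exact Finset.single_le_sum (f := fun j => ω j ^ 2) (fun j _ => sq_nonneg _)
      (Finset.mem_univ j)
  have hZ : ∀ k, volume (Z k) ≤ ENNReal.ofReal (c * α * ‖k‖ ^ (-(τ + 1))) := by
    intro k
    by_cases hk : k = 0
    · simp [Z, hk]
    have hne : Nonempty (Fin n) := ⟨⟨0, hn⟩⟩
    obtain ⟨i, hi⟩ := Finite.exists_max fun j => ‖k j‖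
    have hnorm : ‖k‖ = ‖k i‖ :=
      le_antisymm ((pi_norm_le_iff_of_nonneg (norm_nonneg _)).2 hi) (norm_le_pi_norm k i)
    have hpos : 0 < ‖k‖ := norm_pos_iff.2 hk
    have habs : |(k i : ℝ)| = ‖k‖ := by rw [hnorm]; rfl
    have hki : (k i : ℝ) ≠ 0 := by
      intro h0
      rw [h0, abs_zero] at habs
      exact hpos.ne habs
    have hl1 : ‖k‖ ≤ ((∑ j, |k j| : ℤ) : ℝ) := by
      rw [← habs, ← Int.cast_abs]
      exact_mod_cast Finset.single_le_sum (f := fun j => |k j|) (fun j _ => abs_nonneg _)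
        (Finset.mem_univ i)
    have hδ : α / ((∑ j, |k j| : ℤ) : ℝ) ^ τ ≤ α / ‖k‖ ^ τ := by
      gcongr
    have h1 : Z k ⊆ {ω : Fin n → ℝ | (∀ j, |ω j| ≤ M) ∧
        |∑ j, (k j : ℝ) * ω j| < α / ‖k‖ ^ τ} := fun ω h => ⟨h.2.1, h.2.2.trans_le hδ⟩
    refine (measure_mono h1).trans
      ((volume_slab_le n M _ (fun j => (k j : ℝ)) i hki).trans_eq ?_)
    rw [← ENNReal.ofReal_pow (by positivity), ← ENNReal.ofReal_mul (by positivity),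
      ← ENNReal.ofReal_mul (by positivity), abs_inv, habs, Real.rpow_neg hpos.le,
      Real.rpow_add hpos, Real.rpow_one, hc]
    congr 1
    field_simp
  calc _ ≤ volume (⋃ k, Z k) := measure_mono hsub
    _ ≤ ∑' k, volume (Z k) := measure_iUnion_le _
    _ ≤ ∑' k : Fin n → ℤ, ENNReal.ofReal (c * α * ‖k‖ ^ (-(τ + 1))) := ENNReal.tsum_le_tsum hZ
    _ = ENNReal.ofReal (c * α * T) := by
        rw [← ENNReal.ofReal_tsum_of_nonneg (fun k => by positivity) (hsum.mul_left _),
          tsum_mul_left]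
    _ ≤ ENNReal.ofReal (c * (T + 1) * α) := by
        apply ENNReal.ofReal_le_ofReal
        nlinarith [mul_pos hc0 hα]
end
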